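/- arXiv:2210.04804 — 2 statements merged into one kernel-verified Lean document; each statement's English description precedes it below -/
import Mathlib

section
/- Let J ∈ {ℤ, ℤ⁺, ℤ⁻} and let (A_n)_{n∈J} be a sequence of invertible linear operators on ℝ^d. Then the following are equivalent: (1) (A_n)_{n∈J} admits a nonuniform strong exponential dichotomy; (2) there exists a sequence of norms (‖·‖_n)_{n∈J} on ℝ^d such that (A_n)_{n∈J} admits a strong exponential dichotomy with respect to (‖·‖_n)_{n∈J}, and there exist constants C>0 and δ≥0 such that ‖x‖ ≤ ‖x‖_n ≤ C·e^{δ|n|}·‖x‖ for every x∈ℝ^d and n∈J. -/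
noncomputable section

namespace NonautLin

variable {E : Type*} [NormedAddCommGroup E] [NormedSpace ℝ E]

/-- `N : E → ℝ` is a norm on the real vector space `E`. -/
def IsNormOn (N : E → ℝ) : Prop :=
  (∀ x, 0 ≤ N x) ∧ (∀ x, N x = 0 ↔ x = 0) ∧
  (∀ (c : ℝ) (x : E), N (c • x) = |c| * N x) ∧
  (∀ x y : E, N (x + y) ≤ N x + N y)

/-- `fwdZ A n k` is the composition `A (n+k-1) ∘ ⋯ ∘ A n`. -/
def fwdZ (A : ℤ → (E ≃L[ℝ] E)) (n : ℤ) : ℕ → (E ≃L[ℝ] E)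
  | 0 => ContinuousLinearEquiv.refl ℝ E
  | k + 1 => (fwdZ A n k).trans (A (n + k))

/-- The cocycle `𝒜(m,n)` associated with the two-sided sequence `A`. -/
def cocZ (A : ℤ → (E ≃L[ℝ] E)) (m n : ℤ) : E ≃L[ℝ] E :=
  if n ≤ m then fwdZ A n (m - n).toNat else (fwdZ A m (n - m).toNat).symm

/-- Nonuniform strong exponential dichotomy over an interval `J ⊆ ℤ`. -/
def JNonuniformStrongExpDichotomy (J : Set ℤ) (A : ℤ → (E ≃L[ℝ] E)) : Prop :=
  ∃ K lam a eps : ℝ, 0 < K ∧ 0 < lam ∧ lam ≤ a ∧ 0 ≤ eps ∧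
    ∃ P : ℤ → (E →L[ℝ] E),
      (∀ n ∈ J, (P n).comp (P n) = P n) ∧
      (∀ n : ℤ, n ∈ J → n + 1 ∈ J →
        ((A n : E →L[ℝ] E)).comp (P n) = (P (n + 1)).comp (A n : E →L[ℝ] E)) ∧
      (∀ m n : ℤ, n ∈ J → m ∈ J → n ≤ m →
        ‖((cocZ A m n : E →L[ℝ] E)).comp (P n)‖
          ≤ K * Real.exp (-lam * ((m : ℝ) - n) + eps * |(n : ℝ)|) ∧
        ‖((cocZ A n m : E →L[ℝ] E)).comp (ContinuousLinearMap.id ℝ E - P m)‖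
          ≤ K * Real.exp (-lam * ((m : ℝ) - n) + eps * |(m : ℝ)|) ∧
        ‖(cocZ A m n : E →L[ℝ] E)‖ ≤ K * Real.exp (a * ((m : ℝ) - n) + eps * |(n : ℝ)|) ∧
        ‖(cocZ A n m : E →L[ℝ] E)‖ ≤ K * Real.exp (a * ((m : ℝ) - n) + eps * |(m : ℝ)|))

/-- Strong exponential dichotomy over an interval `J ⊆ ℤ` with respect to a sequence of
norms indexed by `J`. -/
def JStrongExpDichotomyWRT (J : Set ℤ) (A : ℤ → (E ≃L[ℝ] E)) (N : ℤ → E → ℝ) : Prop :=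
  ∃ K lam a : ℝ, 0 < K ∧ 0 < lam ∧ lam ≤ a ∧
    ∃ P : ℤ → (E →L[ℝ] E),
      (∀ n ∈ J, (P n).comp (P n) = P n) ∧
      (∀ n : ℤ, n ∈ J → n + 1 ∈ J →
        ((A n : E →L[ℝ] E)).comp (P n) = (P (n + 1)).comp (A n : E →L[ℝ] E)) ∧
      (∀ m n : ℤ, n ∈ J → m ∈ J → n ≤ m → ∀ x : E,
        N m (cocZ A m n (P n x)) ≤ K * Real.exp (-lam * ((m : ℝ) - n)) * N n x ∧
        N n (cocZ A n m (x - P m x)) ≤ K * Real.exp (-lam * ((m : ℝ) - n)) * N m x ∧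
        N m (cocZ A m n x) ≤ K * Real.exp (a * ((m : ℝ) - n)) * N n x ∧
        N n (cocZ A n m x) ≤ K * Real.exp (a * ((m : ℝ) - n)) * N m x)

theorem fwdZ_succ_eq_trans (A : ℤ → (E ≃L[ℝ] E)) (n : ℤ) (k : ℕ) :
    fwdZ A n (k + 1) = (A n).trans (fwdZ A (n + 1) k) := by
  induction k with
  | zero => ext x; simp [fwdZ]
  | succ k ih =>
    rw [fwdZ, ih, fwdZ, show n + ((k + 1 : ℕ) : ℤ) = n + 1 + k by push_cast; ring]
    rfl

theorem cocZ_self (A : ℤ → (E ≃L[ℝ] E)) (n : ℤ) (x : E) : cocZ A n n x = x := by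
  simp [cocZ, fwdZ]

theorem cocZ_succ_left (A : ℤ → (E ≃L[ℝ] E)) (m n : ℤ) (x : E) :
    cocZ A (m + 1) n x = A m (cocZ A m n x) := by
  rcases le_or_gt n m with h | h
  · obtain ⟨k, rfl⟩ := Int.le.dest h
    have h1 : (n + k + 1 - n).toNat = k + 1 := by omega
    have h2 : (n + k - n).toNat = k := by omega
    rw [cocZ, cocZ, if_pos (by omega), if_pos h, h1, h2]
    rfl
  · obtain ⟨k, rfl⟩ := Int.le.dest (show m + 1 ≤ n by omega)
    have h2 : (m + 1 + k - m).toNat = k + 1 := by omega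
    have h1 : (m + 1 + k - (m + 1)).toNat = k := by omega
    rw [cocZ, cocZ, if_neg (show ¬ m + 1 + (k : ℤ) ≤ m by omega), h2, fwdZ_succ_eq_trans]
    split_ifs with hk
    · obtain rfl : k = 0 := by omega
      simp [fwdZ]
    · rw [h1]
      simp

theorem cocZ_cocZ (A : ℤ → (E ≃L[ℝ] E)) (m k n : ℤ) (x : E) :
    cocZ A m k (cocZ A k n x) = cocZ A m n x := by
  induction m using Int.inductionOn' (b := k) with
  | zero => exact cocZ_self A k _
  | succ m _ ih => rw [cocZ_succ_left, ih, cocZ_succ_left]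
  | pred m _ ih =>
    apply (A (m - 1)).injective
    rw [← cocZ_succ_left, ← cocZ_succ_left, sub_add_cancel, ih]

/-- Projections intertwined by the sequence are intertwined by its cocycle. -/
theorem cocZ_intertwine {J : Set ℤ} (hJ : J.OrdConnected) {A : ℤ → (E ≃L[ℝ] E)}
    {P : ℤ → (E →L[ℝ] E)}
    (hP : ∀ n : ℤ, n ∈ J → n + 1 ∈ J →
      ((A n : E →L[ℝ] E)).comp (P n) = (P (n + 1)).comp (A n : E →L[ℝ] E))
    {m n : ℤ} (hm : m ∈ J) (hn : n ∈ J) (x : E) :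
    P m (cocZ A m n x) = cocZ A m n (P n x) := by
  have key : ∀ n ∈ J, ∀ m, n ≤ m → m ∈ J → ∀ x,
      P m (cocZ A m n x) = cocZ A m n (P n x) := by
    intro n hn m hnm
    induction m, hnm using Int.leInduction with
    | base => intro _ x; rw [cocZ_self, cocZ_self]
    | succ m hnm ih =>
      intro hm x
      have hmJ : m ∈ J := hJ.out hn hm ⟨hnm, by omega⟩
      rw [cocZ_succ_left, cocZ_succ_left, ← ih hmJ]
      exact (DFunLike.congr_fun (hP m hmJ hm) (cocZ A m n x)).symm
  rcases le_total n m with h | h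
  · exact key n hn m h hm x
  · apply (cocZ A n m).injective
    rw [← key m hm n h hn, cocZ_cocZ, cocZ_cocZ, cocZ_self, cocZ_self]

/-- The weighted supremum of the orbit of `R n x` over the times in `J`. -/
def lyapunovSup (J : Set ℤ) (A : ℤ → (E ≃L[ℝ] E)) (w : ℝ → ℝ) (R : ℤ → (E →L[ℝ] E))
    (n : ℤ) (x : E) : ℝ :=
  ⨆ m : J, Real.exp (w ((m : ℤ) - n)) * ‖cocZ A m n (R n x)‖

section LyapunovSup

variable {J : Set ℤ} {A : ℤ → (E ≃L[ℝ] E)} {w : ℝ → ℝ} {R : ℤ → (E →L[ℝ] E)} {B : ℤ → ℝ}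

theorem lyapunovSup_nonneg (n : ℤ) (x : E) : 0 ≤ lyapunovSup J A w R n x :=
  Real.iSup_nonneg fun _ => by positivity

theorem le_lyapunovSup
    (hB : ∀ m ∈ J, ∀ n ∈ J, ∀ x, Real.exp (w (m - n)) * ‖cocZ A m n (R n x)‖ ≤ B n * ‖x‖)
    {m n : ℤ} (hm : m ∈ J) (hn : n ∈ J) (x : E) :
    Real.exp (w (m - n)) * ‖cocZ A m n (R n x)‖ ≤ lyapunovSup J A w R n x := by
  refine le_ciSup (f := fun m : J => Real.exp (w ((m : ℤ) - n)) * ‖cocZ A m n (R n x)‖)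
    ⟨B n * ‖x‖, ?_⟩ ⟨m, hm⟩
  rintro _ ⟨k, rfl⟩
  exact hB k k.2 n hn x

theorem lyapunovSup_le {n : ℤ} (hn : n ∈ J) {x : E} {c : ℝ}
    (h : ∀ m ∈ J, Real.exp (w (m - n)) * ‖cocZ A m n (R n x)‖ ≤ c) :
    lyapunovSup J A w R n x ≤ c :=
  haveI : Nonempty J := ⟨⟨n, hn⟩⟩
  ciSup_le fun m => h m m.2

theorem lyapunovSup_smul (n : ℤ) (c : ℝ) (x : E) :
    lyapunovSup J A w R n (c • x) = |c| * lyapunovSup J A w R n x := by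
  rw [lyapunovSup, lyapunovSup, Real.mul_iSup_of_nonneg (abs_nonneg c)]
  refine iSup_congr fun m => ?_
  rw [map_smul, map_smul, norm_smul, Real.norm_eq_abs]
  ring

theorem lyapunovSup_add_le
    (hB : ∀ m ∈ J, ∀ n ∈ J, ∀ x, Real.exp (w (m - n)) * ‖cocZ A m n (R n x)‖ ≤ B n * ‖x‖)
    {n : ℤ} (hn : n ∈ J) (x y : E) :
    lyapunovSup J A w R n (x + y) ≤ lyapunovSup J A w R n x + lyapunovSup J A w R n y := by
  refine lyapunovSup_le hn fun m hm => ?_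
  refine le_trans ?_ (add_le_add (le_lyapunovSup hB hm hn x) (le_lyapunovSup hB hm hn y))
  rw [map_add, map_add, ← mul_add]
  gcongr
  exact norm_add_le _ _

theorem lyapunovSup_eq_zero {n : ℤ} {x : E} (h : R n x = 0) :
    lyapunovSup J A w R n x = 0 := by
  simp [lyapunovSup, h]

theorem norm_le_lyapunovSup
    (hB : ∀ m ∈ J, ∀ n ∈ J, ∀ x, Real.exp (w (m - n)) * ‖cocZ A m n (R n x)‖ ≤ B n * ‖x‖)
    (hw : w 0 = 0) {n : ℤ} (hn : n ∈ J) (x : E) :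
    ‖R n x‖ ≤ lyapunovSup J A w R n x := by
  simpa [hw, cocZ_self] using le_lyapunovSup hB hn hn x

/-- If the weight grows by at least `b` under a shift by `m - n`, then the cocycle from time `n`
to time `m` contracts `lyapunovSup` by the factor `exp (-b)`. -/
theorem lyapunovSup_cocZ_le
    (hB : ∀ m ∈ J, ∀ n ∈ J, ∀ x, Real.exp (w (m - n)) * ‖cocZ A m n (R n x)‖ ≤ B n * ‖x‖)
    (hR : ∀ m ∈ J, ∀ n ∈ J, ∀ x, R m (cocZ A m n x) = cocZ A m n (R n x))
    {m n : ℤ} (hm : m ∈ J) (hn : n ∈ J) {b : ℝ} (hb : ∀ j : ℝ, w j + b ≤ w (j + (m - n)))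
    (x : E) :
    lyapunovSup J A w R m (cocZ A m n x) ≤ Real.exp (-b) * lyapunovSup J A w R n x := by
  refine lyapunovSup_le hm fun k hk => ?_
  rw [hR m hm n hn, cocZ_cocZ]
  have h := hb (k - m)
  rw [sub_add_sub_cancel] at h
  calc Real.exp (w (k - m)) * ‖cocZ A k n (R n x)‖
      ≤ Real.exp (-b + w (k - n)) * ‖cocZ A k n (R n x)‖ := by gcongr; linarith
    _ = Real.exp (-b) * (Real.exp (w (k - n)) * ‖cocZ A k n (R n x)‖) := by
      rw [Real.exp_add, mul_assoc]
    _ ≤ _ := by gcongr; exact le_lyapunovSup hB hk hn x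

end LyapunovSup

/-- The exponent `min (lam * t) (a * t)`: rate `lam` forwards, rate `a` backwards. -/
def dichotomyWeight (lam a t : ℝ) : ℝ := min (lam * t) (a * t)

theorem dichotomyWeight_add {lam a p : ℝ} (h : lam ≤ a) (hp : 0 ≤ p) (t : ℝ) :
    dichotomyWeight lam a t + lam * p ≤ dichotomyWeight lam a (t + p) := by
  have h1 : lam * p ≤ a * p := by gcongr
  have h2 := min_le_left (lam * t) (a * t)
  have h3 := min_le_right (lam * t) (a * t)
  unfold dichotomyWeight
  apply le_min <;> linarith

theorem dichotomyWeight_sub {lam a p : ℝ} (h : lam ≤ a) (hp : 0 ≤ p) (t : ℝ) :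
    dichotomyWeight lam a t - a * p ≤ dichotomyWeight lam a (t - p) := by
  have h1 : lam * p ≤ a * p := by gcongr
  have h2 := min_le_left (lam * t) (a * t)
  have h3 := min_le_right (lam * t) (a * t)
  unfold dichotomyWeight
  apply le_min <;> linarith

/-- An exponential bound `‖T‖ ≤ K * exp (-u + e)` cancels a weight of exponent `u`. -/
theorem exp_mul_norm_apply_le {T : E →L[ℝ] E} {K u v e : ℝ} (hT : ‖T‖ ≤ K * Real.exp (v + e))
    (hv : u + v ≤ 0) (hK : 0 < K) (x : E) :
    Real.exp u * ‖T x‖ ≤ K * Real.exp e * ‖x‖ := by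
  calc Real.exp u * ‖T x‖ ≤ Real.exp u * (K * Real.exp (v + e) * ‖x‖) := by
        gcongr; exact T.le_of_opNorm_le hT x
    _ = K * Real.exp (u + v + e) * ‖x‖ := by
        rw [add_assoc, Real.exp_add u]; ring
    _ ≤ _ := by gcongr; linarith

theorem JStrongExpDichotomyWRT.jNonuniformStrongExpDichotomy {J : Set ℤ}
    {A : ℤ → (E ≃L[ℝ] E)} {N : ℤ → E → ℝ} (h : JStrongExpDichotomyWRT J A N) {C δ : ℝ}
    (hC : 0 < C) (hδ : 0 ≤ δ)
    (hN : ∀ n ∈ J, ∀ x, ‖x‖ ≤ N n x ∧ N n x ≤ C * Real.exp (δ * |(n : ℝ)|) * ‖x‖) :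
    JNonuniformStrongExpDichotomy J A := by
  obtain ⟨K, lam, a, hK, hlam, hla, P, hP, hAP, hb⟩ := h
  have key : ∀ (T : E →L[ℝ] E) (u : ℝ), ∀ m ∈ J, ∀ n ∈ J,
      (∀ x, N m (T x) ≤ K * Real.exp u * N n x) →
      ‖T‖ ≤ K * C * Real.exp (u + δ * |(n : ℝ)|) := by
    intro T u m hm n hn hT
    refine T.opNorm_le_bound (by positivity) fun x => ?_
    calc ‖T x‖ ≤ K * Real.exp u * N n x := ((hN m hm _).1).trans (hT x)
      _ ≤ K * Real.exp u * (C * Real.exp (δ * |(n : ℝ)|) * ‖x‖) := by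
        gcongr; exact (hN n hn x).2
      _ = _ := by rw [Real.exp_add]; ring
  refine ⟨K * C, lam, a, δ, by positivity, hlam, hla, hδ, P, hP, hAP, fun m n hn hm hnm => ?_⟩
  have hb := hb m n hn hm hnm
  exact ⟨key _ _ m hm n hn fun x => (hb x).1, key _ _ n hn m hm fun x => (hb x).2.1,
    key _ _ m hm n hn fun x => (hb x).2.2.1, key _ _ n hn m hm fun x => (hb x).2.2.2⟩

theorem JNonuniformStrongExpDichotomy.exists_norms {J : Set ℤ} (hJ : J.OrdConnected)
    {A : ℤ → (E ≃L[ℝ] E)} (h : JNonuniformStrongExpDichotomy J A) :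
    ∃ N : ℤ → E → ℝ, (∀ n ∈ J, IsNormOn (N n)) ∧ JStrongExpDichotomyWRT J A N ∧
      ∃ C δ : ℝ, 0 < C ∧ 0 ≤ δ ∧
        ∀ n ∈ J, ∀ x, ‖x‖ ≤ N n x ∧ N n x ≤ C * Real.exp (δ * |(n : ℝ)|) * ‖x‖ := by
  obtain ⟨K, lam, a, eps, hK, hlam, hla, heps, P, hP, hAP, hb⟩ := h
  set Q : ℤ → (E →L[ℝ] E) := fun n => ContinuousLinearMap.id ℝ E - P n with hQ
  set wP : ℝ → ℝ := dichotomyWeight lam a with hwP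
  set wQ : ℝ → ℝ := fun t => dichotomyWeight lam a (-t) with hwQ
  set b : ℤ → ℝ := fun n => K * Real.exp (eps * |(n : ℝ)|) with hbdef
  set B : ℤ → ℝ := fun n => b n + b n * b n with hBdef
  have hb0 : ∀ n, 0 < b n := fun n => by positivity
  have hbB : ∀ n x, b n * ‖(x : E)‖ ≤ B n * ‖x‖ := fun n x => by
    have := hb0 n
    gcongr
    simp only [hBdef]
    nlinarith
  have hbbB : ∀ n (x y : E), ‖y‖ ≤ b n * ‖x‖ → b n * ‖y‖ ≤ B n * ‖x‖ := fun n x y h => by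
    have h0 := hb0 n
    calc b n * ‖y‖ ≤ b n * (b n * ‖x‖) := by gcongr
      _ ≤ B n * ‖x‖ := by
        have : 0 ≤ b n * ‖x‖ := by positivity
        simp only [hBdef]
        linarith
  have hPn : ∀ n ∈ J, ∀ x, ‖P n x‖ ≤ b n * ‖x‖ := fun n hn x => by
    have h := exp_mul_norm_apply_le (u := 0) (hb n n hn hn le_rfl).1 (by simp) hK x
    simpa [cocZ_self, hbdef] using h
  have hQn : ∀ n ∈ J, ∀ x, ‖Q n x‖ ≤ b n * ‖x‖ := fun n hn x => by
    have h := exp_mul_norm_apply_le (u := 0) (hb n n hn hn le_rfl).2.1 (by simp) hK x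
    simpa [cocZ_self, hQ, hbdef] using h
  have hBP : ∀ m ∈ J, ∀ n ∈ J, ∀ x,
      Real.exp (wP (m - n)) * ‖cocZ A m n (P n x)‖ ≤ B n * ‖x‖ := by
    intro m hm n hn x
    rcases le_total n m with hnm | hnm
    · refine le_trans ?_ (hbB n x)
      refine exp_mul_norm_apply_le (hb m n hn hm hnm).1 ?_ hK x
      have := min_le_left (lam * ((m : ℝ) - n)) (a * ((m : ℝ) - n))
      simp only [hwP, dichotomyWeight]
      linarith
    · refine le_trans ?_ (hbbB n x _ (hPn n hn x))
      refine exp_mul_norm_apply_le (hb n m hm hn hnm).2.2.2 ?_ hK _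
      have := min_le_right (lam * ((m : ℝ) - n)) (a * ((m : ℝ) - n))
      simp only [hwP, dichotomyWeight]
      linarith
  have hBQ : ∀ m ∈ J, ∀ n ∈ J, ∀ x,
      Real.exp (wQ (m - n)) * ‖cocZ A m n (Q n x)‖ ≤ B n * ‖x‖ := by
    intro m hm n hn x
    rcases le_total n m with hnm | hnm
    · refine le_trans ?_ (hbbB n x _ (hQn n hn x))
      refine exp_mul_norm_apply_le (hb m n hn hm hnm).2.2.1 ?_ hK _
      have := min_le_right (lam * -((m : ℝ) - n)) (a * -((m : ℝ) - n))
      simp only [hwQ, dichotomyWeight]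
      linarith
    · refine le_trans ?_ (hbB n x)
      refine exp_mul_norm_apply_le (hb n m hm hn hnm).2.1 ?_ hK x
      have := min_le_left (lam * -((m : ℝ) - n)) (a * -((m : ℝ) - n))
      simp only [hwQ, dichotomyWeight]
      linarith
  have hRP : ∀ m ∈ J, ∀ n ∈ J, ∀ x, P m (cocZ A m n x) = cocZ A m n (P n x) :=
    fun m hm n hn x => cocZ_intertwine hJ hAP hm hn x
  have hRQ : ∀ m ∈ J, ∀ n ∈ J, ∀ x, Q m (cocZ A m n x) = cocZ A m n (Q n x) :=
    fun m hm n hn x => by simp [hQ, hRP m hm n hn]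
  have hPP : ∀ n ∈ J, ∀ x, P n (P n x) = P n x := fun n hn x => DFunLike.congr_fun (hP n hn) x
  set N : ℤ → E → ℝ := fun n x => lyapunovSup J A wP P n x + lyapunovSup J A wQ Q n x with hN
  have hlow : ∀ n ∈ J, ∀ x, ‖x‖ ≤ N n x := by
    intro n hn x
    calc ‖x‖ = ‖P n x + Q n x‖ := by simp [hQ]
      _ ≤ ‖P n x‖ + ‖Q n x‖ := norm_add_le _ _
      _ ≤ N n x := add_le_add
        (norm_le_lyapunovSup hBP (by simp [hwP, dichotomyWeight]) hn x)
        (norm_le_lyapunovSup hBQ (by simp [hwQ, dichotomyWeight]) hn x)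
  have hsmul : ∀ n (c : ℝ) x, N n (c • x) = |c| * N n x := fun n c x => by
    simp only [hN, lyapunovSup_smul]; ring
  have htransfer : ∀ m ∈ J, ∀ n ∈ J, ∀ u : ℝ, (∀ j, wP j + -u ≤ wP (j + (m - n))) →
      (∀ j, wQ j + -u ≤ wQ (j + (m - n))) → ∀ x, N m (cocZ A m n x) ≤ 1 * Real.exp u * N n x := by
    intro m hm n hn u h1 h2 x
    have h3 := lyapunovSup_cocZ_le hBP hRP hm hn h1 x
    have h4 := lyapunovSup_cocZ_le hBQ hRQ hm hn h2 x
    rw [neg_neg] at h3 h4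
    rw [one_mul, hN, mul_add]
    exact add_le_add h3 h4
  refine ⟨N, fun n hn => ⟨fun x => (norm_nonneg x).trans (hlow n hn x), fun x => ⟨fun h => ?_, ?_⟩,
    hsmul n, fun x y => ?_⟩, ⟨1, lam, a, one_pos, hlam, hla, P, hP, hAP, ?_⟩,
    2 * (K + K * K), 2 * eps, by positivity, by positivity, fun n hn x => ⟨hlow n hn x, ?_⟩⟩
  · exact norm_le_zero_iff.1 (h ▸ hlow n hn x)
  · rintro rfl
    simpa using hsmul n 0 0
  · have h1 := lyapunovSup_add_le hBP hn x y
    have h2 := lyapunovSup_add_le hBQ hn x y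
    simp only [hN]
    linarith
  · intro m n hn hm hnm x
    have hp : (0 : ℝ) ≤ (m : ℝ) - n := sub_nonneg.2 (Int.cast_le.2 hnm)
    have hap : lam * ((m : ℝ) - n) ≤ a * ((m : ℝ) - n) := by gcongr
    have hlp : 0 ≤ lam * ((m : ℝ) - n) := by positivity
    have hadd := fun t => dichotomyWeight_add hla hp t
    have hsub := fun t => dichotomyWeight_sub hla hp t
    have hQadd : ∀ j, wQ j + lam * ((m : ℝ) - n) ≤ wQ (j + (n - m)) := fun j => by
      simpa only [hwQ, show -(j + ((n : ℝ) - m)) = -j + (m - n) by ring] using hadd (-j)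
    have hQsub : ∀ j, wQ j - a * ((m : ℝ) - n) ≤ wQ (j + (m - n)) := fun j => by
      simpa only [hwQ, show -(j + ((m : ℝ) - n)) = -j - (m - n) by ring] using hsub (-j)
    have hPsub : ∀ j, wP j - a * ((m : ℝ) - n) ≤ wP (j + (n - m)) := fun j => by
      simpa only [hwP, show j + ((n : ℝ) - m) = j - (m - n) by ring] using hsub j
    refine ⟨?_, ?_, ?_, ?_⟩
    · have h1 := lyapunovSup_cocZ_le hBP hRP hm hn hadd (P n x)
      have h2 : lyapunovSup J A wQ Q m (cocZ A m n (P n x)) = 0 :=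
        lyapunovSup_eq_zero (by rw [hRQ m hm n hn]; simp [hQ, hPP n hn])
      have h3 : lyapunovSup J A wP P n (P n x) = lyapunovSup J A wP P n x := by
        simp only [lyapunovSup, hPP n hn]
      rw [h3] at h1
      have h4 : lyapunovSup J A wP P n x ≤ N n x :=
        le_add_of_nonneg_right (lyapunovSup_nonneg n x)
      rw [one_mul, neg_mul]
      calc N m (cocZ A m n (P n x)) = lyapunovSup J A wP P m (cocZ A m n (P n x)) := by
            simp only [hN, h2, add_zero]
        _ ≤ _ := h1.trans (by gcongr)
    · have h1 := lyapunovSup_cocZ_le hBQ hRQ hn hm hQadd (Q m x)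
      have h2 : lyapunovSup J A wP P n (cocZ A n m (Q m x)) = 0 :=
        lyapunovSup_eq_zero (by rw [hRP n hn m hm]; simp [hQ, hPP m hm])
      have h3 : lyapunovSup J A wQ Q m (Q m x) = lyapunovSup J A wQ Q m x := by
        have hQQ : Q m (Q m x) = Q m x := by simp [hQ, hPP m hm]
        simp only [lyapunovSup, hQQ]
      rw [h3] at h1
      have h4 : lyapunovSup J A wQ Q m x ≤ N m x :=
        le_add_of_nonneg_left (lyapunovSup_nonneg m x)
      rw [one_mul, neg_mul]
      calc N n (cocZ A n m (Q m x)) = lyapunovSup J A wQ Q n (cocZ A n m (Q m x)) := by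
            simp only [hN, h2, zero_add]
        _ ≤ _ := h1.trans (by gcongr)
    · exact htransfer m hm n hn _ (fun j => by linarith [hadd j]) (fun j => by
        linarith [hQsub j]) x
    · exact htransfer n hn m hm _ (fun j => by linarith [hPsub j]) (fun j => by
        linarith [hQadd j]) x
  · have h1 := lyapunovSup_le hn fun m hm => hBP m hm n hn x
    have h2 := lyapunovSup_le hn fun m hm => hBQ m hm n hn x
    have h3 : 1 ≤ Real.exp (eps * |(n : ℝ)|) := Real.one_le_exp (by positivity)
    have h4 : B n ≤ (K + K * K) * Real.exp (2 * eps * |(n : ℝ)|) := by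
      rw [show 2 * eps * |(n : ℝ)| = eps * |(n : ℝ)| + eps * |(n : ℝ)| by ring, Real.exp_add]
      simp only [hBdef, hbdef]
      have : K * Real.exp (eps * |(n : ℝ)|) * 1 ≤
          K * Real.exp (eps * |(n : ℝ)|) * Real.exp (eps * |(n : ℝ)|) := by gcongr
      linarith
    have h5 := mul_le_mul_of_nonneg_right h4 (norm_nonneg x)
    simp only [hN]
    linarith

/-- Proposition: characterization of nonuniform strong exponential
dichotomies via sequences of norms, over `J ∈ {ℤ, ℤ⁺, ℤ⁻}`. -/
theorem jNonuniformStrongExpDichotomy_iff_exists_norms {d : ℕ} (J : Set ℤ)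
    (hJ : J = Set.univ ∨ J = {n : ℤ | 0 ≤ n} ∨ J = {n : ℤ | n ≤ 0})
    (A : ℤ → (EuclideanSpace ℝ (Fin d) ≃L[ℝ] EuclideanSpace ℝ (Fin d))) :
    JNonuniformStrongExpDichotomy J A ↔
      ∃ N : ℤ → EuclideanSpace ℝ (Fin d) → ℝ,
        (∀ n ∈ J, IsNormOn (N n)) ∧
        JStrongExpDichotomyWRT J A N ∧
        ∃ C δ : ℝ, 0 < C ∧ 0 ≤ δ ∧
          ∀ n ∈ J, ∀ x : EuclideanSpace ℝ (Fin d),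
            ‖x‖ ≤ N n x ∧ N n x ≤ C * Real.exp (δ * |(n : ℝ)|) * ‖x‖ := by
  have hJ' : J.OrdConnected := by
    rcases hJ with rfl | rfl | rfl
    · exact Set.ordConnected_univ
    · exact Set.ordConnected_Ici
    · exact Set.ordConnected_Iic
  constructor
  · exact fun h => h.exists_norms hJ'
  · rintro ⟨N, -, h, C, δ, hC, hδ, hN⟩
    exact h.jNonuniformStrongExpDichotomy hC hδ hN

end NonautLin
end
end

section
/- Let (‖·‖_n)_{n∈ℕ} be a sequence of norms on ℝ^d and let (A_n)_{n∈ℕ} be a sequence of invertible linear operators on ℝ^d for which there exist K,a>0 such that ‖𝒜(m,n)x‖_m ≤ K(m/n)^a‖x‖_n and ‖𝒜(n,m)x‖_n ≤ K(m/n)^a‖x‖_m for all m≥n in ℕ and x∈ℝ^d. Define B_n := 𝒜(2^{n+1}, 2^n) for n∈ℤ⁺. Then the following are equivalent: (1) (A_n)_{n∈ℕ} admits a strong polynomial dichotomy with respect to (‖·‖_n)_{n∈ℕ}; (2) (B_n)_{n∈ℤ⁺} admits a strong exponential dichotomy with respect to the sequence of norms (‖·‖_{2^n})_{n∈ℤ⁺}.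 -/
noncomputable section

namespace NonautLin

variable {E : Type*} [NormedAddCommGroup E] [NormedSpace ℝ E]

/-- `fwd A n k` is the composition `A (n+k-1) ∘ ⋯ ∘ A n`. -/
def fwd (A : ℕ → (E ≃L[ℝ] E)) (n : ℕ) : ℕ → (E ≃L[ℝ] E)
  | 0 => ContinuousLinearEquiv.refl ℝ E
  | k + 1 => (fwd A n k).trans (A (n + k))

/-- The cocycle `𝒜(m,n)` associated with the one-sided sequence `A`:
`𝒜(m,n) = A (m-1) ∘ ⋯ ∘ A n` for `m > n`, `𝒜(n,n) = Id`, and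
`𝒜(m,n) = (𝒜(n,m))⁻¹` for `m < n`. -/
def coc (A : ℕ → (E ≃L[ℝ] E)) (m n : ℕ) : E ≃L[ℝ] E :=
  if n ≤ m then fwd A n (m - n) else (fwd A m (n - m)).symm

/-- Nonuniform strong polynomial dichotomy (indices `n ≥ 1`), with nonuniformity
exponent `eps`. -/
def NonuniformStrongPolyDichotomyWith (A : ℕ → (E ≃L[ℝ] E)) (eps : ℝ) : Prop :=
  ∃ K lam a : ℝ, 0 < K ∧ 0 < lam ∧ lam ≤ a ∧
    ∃ P : ℕ → (E →L[ℝ] E),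
      (∀ n, 1 ≤ n → (P n).comp (P n) = P n) ∧
      (∀ n, 1 ≤ n → ((A n : E →L[ℝ] E)).comp (P n) = (P (n + 1)).comp (A n : E →L[ℝ] E)) ∧
      (∀ m n : ℕ, 1 ≤ n → n ≤ m →
        ‖((coc A m n : E →L[ℝ] E)).comp (P n)‖ ≤ K * ((m : ℝ) / n) ^ (-lam) * (n : ℝ) ^ eps ∧
        ‖((coc A n m : E →L[ℝ] E)).comp (ContinuousLinearMap.id ℝ E - P m)‖
          ≤ K * ((m : ℝ) / n) ^ (-lam) * (m : ℝ) ^ eps ∧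
        ‖(coc A m n : E →L[ℝ] E)‖ ≤ K * ((m : ℝ) / n) ^ a * (n : ℝ) ^ eps ∧
        ‖(coc A n m : E →L[ℝ] E)‖ ≤ K * ((m : ℝ) / n) ^ a * (m : ℝ) ^ eps)

/-- Nonuniform strong polynomial dichotomy (indices `n ≥ 1`). -/
def NonuniformStrongPolyDichotomy (A : ℕ → (E ≃L[ℝ] E)) : Prop :=
  ∃ eps : ℝ, 0 ≤ eps ∧ NonuniformStrongPolyDichotomyWith A eps

/-- Strong polynomial dichotomy with respect to a sequence of norms (indices `n ≥ 1`). -/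
def StrongPolyDichotomyWRT (A : ℕ → (E ≃L[ℝ] E)) (N : ℕ → E → ℝ) : Prop :=
  ∃ K lam a : ℝ, 0 < K ∧ 0 < lam ∧ lam ≤ a ∧
    ∃ P : ℕ → (E →L[ℝ] E),
      (∀ n, 1 ≤ n → (P n).comp (P n) = P n) ∧
      (∀ n, 1 ≤ n → ((A n : E →L[ℝ] E)).comp (P n) = (P (n + 1)).comp (A n : E →L[ℝ] E)) ∧
      (∀ m n : ℕ, 1 ≤ n → n ≤ m → ∀ x : E,
        N m (coc A m n (P n x)) ≤ K * ((m : ℝ) / n) ^ (-lam) * N n x ∧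
        N n (coc A n m (x - P m x)) ≤ K * ((m : ℝ) / n) ^ (-lam) * N m x ∧
        N m (coc A m n x) ≤ K * ((m : ℝ) / n) ^ a * N n x ∧
        N n (coc A n m x) ≤ K * ((m : ℝ) / n) ^ a * N m x)

/-- Strong exponential dichotomy, over `ℤ⁺`, with respect to a sequence of norms and a
given sequence of projections. -/
def StrongExpDichotomyWRTProj (B : ℕ → (E ≃L[ℝ] E)) (N : ℕ → E → ℝ)
    (P : ℕ → (E →L[ℝ] E)) : Prop :=
  ∃ K lam a : ℝ, 0 < K ∧ 0 < lam ∧ lam ≤ a ∧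
    (∀ n, (P n).comp (P n) = P n) ∧
    (∀ n, ((B n : E →L[ℝ] E)).comp (P n) = (P (n + 1)).comp (B n : E →L[ℝ] E)) ∧
    (∀ m n : ℕ, n ≤ m → ∀ x : E,
      N m (coc B m n (P n x)) ≤ K * Real.exp (-lam * ((m : ℝ) - n)) * N n x ∧
      N n (coc B n m (x - P m x)) ≤ K * Real.exp (-lam * ((m : ℝ) - n)) * N m x ∧
      N m (coc B m n x) ≤ K * Real.exp (a * ((m : ℝ) - n)) * N n x ∧
      N n (coc B n m x) ≤ K * Real.exp (a * ((m : ℝ) - n)) * N m x)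

/-- Strong exponential dichotomy, over `ℤ⁺`, with respect to a sequence of norms. -/
def StrongExpDichotomyWRT (B : ℕ → (E ≃L[ℝ] E)) (N : ℕ → E → ℝ) : Prop :=
  ∃ P : ℕ → (E →L[ℝ] E), StrongExpDichotomyWRTProj B N P

theorem fwd_add (A : ℕ → (E ≃L[ℝ] E)) (n k : ℕ) :
    fwd A 0 (n + k) = (fwd A 0 n).trans (fwd A n k) := by
  induction k with
  | zero => rfl
  | succ k ih =>
    ext x
    have h := DFunLike.congr_fun ih x
    change A (0 + (n + k)) (fwd A 0 (n + k) x) = A (n + k) (fwd A n k (fwd A 0 n x))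
    rw [h, zero_add, ContinuousLinearEquiv.trans_apply]

theorem coc_apply (A : ℕ → (E ≃L[ℝ] E)) (m n : ℕ) (x : E) :
    coc A m n x = fwd A 0 m ((fwd A 0 n).symm x) := by
  unfold coc
  split_ifs with h
  · obtain ⟨k, rfl⟩ := Nat.exists_eq_add_of_le h
    simp [fwd_add]
  · obtain ⟨k, rfl⟩ := Nat.exists_eq_add_of_le (not_le.1 h).le
    simp [fwd_add]

@[simp]
theorem coc_coc (A : ℕ → (E ≃L[ℝ] E)) (m k n : ℕ) (x : E) :
    coc A m k (coc A k n x) = coc A m n x := by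
  simp [coc_apply]

@[simp]
theorem coc_self (A : ℕ → (E ≃L[ℝ] E)) (n : ℕ) (x : E) : coc A n n x = x := by
  simp [coc_apply]

theorem coc_succ (A : ℕ → (E ≃L[ℝ] E)) (n : ℕ) (x : E) : coc A (n + 1) n x = A n x := by
  simp [coc_apply, fwd]

theorem coc_dyadic (A : ℕ → (E ≃L[ℝ] E)) (m n : ℕ) (x : E) :
    coc (fun k : ℕ => coc A (2 ^ (k + 1)) (2 ^ k)) m n x = coc A (2 ^ m) (2 ^ n) x := by
  have key : ∀ (j : ℕ) (y : E),
      fwd (fun k : ℕ => coc A (2 ^ (k + 1)) (2 ^ k)) 0 j y = coc A (2 ^ j) (2 ^ 0) y := by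
    intro j
    induction j with
    | zero => intro y; simp [fwd]
    | succ j ih => intro y; simp [fwd, ih]
  rw [coc_apply, key]
  obtain ⟨y, rfl⟩ := (fwd (fun k : ℕ => coc A (2 ^ (k + 1)) (2 ^ k)) 0 n).surjective x
  rw [ContinuousLinearEquiv.symm_apply_apply, key, coc_coc]

/-- Projections commuting with the sequence from index `s` on commute with its cocycle. -/
theorem coc_comm {A : ℕ → (E ≃L[ℝ] E)} {P : ℕ → (E →L[ℝ] E)} {s : ℕ}
    (h : ∀ n, s ≤ n →
      ((A n : E →L[ℝ] E)).comp (P n) = (P (n + 1)).comp (A n : E →L[ℝ] E))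
    {m n : ℕ} (hn : s ≤ n) (hm : n ≤ m) (x : E) :
    coc A m n (P n x) = P m (coc A m n x) := by
  induction m, hm using Nat.le_induction with
  | base => simp
  | succ m hm ih =>
    have hA := DFunLike.congr_fun (h m (hn.trans hm)) (coc A m n x)
    simp only [ContinuousLinearMap.comp_apply, ContinuousLinearEquiv.coe_coe] at hA
    rw [← coc_coc A (m + 1) m n, ih, coc_succ, hA, ← coc_succ, coc_coc]

theorem two_pow_div_two_pow_rpow (m n : ℕ) (c : ℝ) :
    (((2 ^ m : ℕ) : ℝ) / ((2 ^ n : ℕ) : ℝ)) ^ c = Real.exp (c * Real.log 2 * ((m : ℝ) - n)) := by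
  rw [Real.rpow_def_of_pos (by positivity)]
  push_cast
  rw [Real.log_div (by positivity) (by positivity), Real.log_pow, Real.log_pow]
  ring_nf

theorem div_two_pow_log_rpow_le {n : ℕ} {a : ℝ} (ha : 0 ≤ a) :
    ((n : ℝ) / ((2 ^ Nat.log 2 n : ℕ) : ℝ)) ^ a ≤ 2 ^ a := by
  refine Real.rpow_le_rpow (by positivity) ?_ ha
  rw [div_le_iff₀ (by positivity)]
  have h := (Nat.lt_pow_succ_log_self (b := 2) one_lt_two n).le
  rw [pow_succ'] at h
  exact_mod_cast h

theorem exp_neg_log_sub_log_le {m n : ℕ} (hn : 1 ≤ n) (hm : 1 ≤ m) {lam : ℝ} (hlam : 0 ≤ lam) :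
    Real.exp (-lam * ((Nat.log 2 m : ℝ) - (Nat.log 2 n : ℕ))) ≤
      Real.exp lam * ((m : ℝ) / n) ^ (-(lam / Real.log 2)) := by
  have hn' : (0 : ℝ) < n := by exact_mod_cast hn
  have hm' : (0 : ℝ) < m := by exact_mod_cast hm
  have hlog : 0 < Real.log 2 := Real.log_pos one_lt_two
  have hup : Real.log m ≤ Real.log 2 * (Nat.log 2 m + 1) := by
    have h := (Nat.lt_pow_succ_log_self (b := 2) one_lt_two m).le
    have h' : (m : ℝ) ≤ 2 ^ (Nat.log 2 m + 1) := by exact_mod_cast h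
    have := Real.log_le_log hm' h'
    rw [Real.log_pow] at this
    push_cast at this
    linarith
  have hlow : Real.log 2 * Nat.log 2 n ≤ Real.log n := by
    have h := Nat.pow_log_le_self 2 (x := n) (by omega)
    have h' : (2 : ℝ) ^ (Nat.log 2 n) ≤ n := by exact_mod_cast h
    have := Real.log_le_log (by positivity) h'
    rw [Real.log_pow] at this
    linarith
  rw [Real.rpow_def_of_pos (by positivity), ← Real.exp_add, Real.log_div hm'.ne' hn'.ne',
    Real.exp_le_exp]
  have h : lam / Real.log 2 * (Real.log m - Real.log n) ≤
      lam / Real.log 2 * (Real.log 2 * (Nat.log 2 m + 1 - Nat.log 2 n)) := by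
    gcongr
    linarith
  have e : lam / Real.log 2 * (Real.log 2 * (Nat.log 2 m + 1 - Nat.log 2 n)) =
      lam * (Nat.log 2 m + 1 - Nat.log 2 n) := by
    field_simp
  linarith

theorem StrongPolyDichotomyWRT.dyadic {A : ℕ → (E ≃L[ℝ] E)} {N : ℕ → E → ℝ}
    (h : StrongPolyDichotomyWRT A N) :
    StrongExpDichotomyWRT (fun n : ℕ => coc A (2 ^ (n + 1)) (2 ^ n))
      (fun n : ℕ => N (2 ^ n)) := by
  obtain ⟨K, lam, a, hK, hlam, hla, P, hP, hAP, hb⟩ := h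
  have hlog : 0 < Real.log 2 := Real.log_pos one_lt_two
  refine ⟨fun n => P (2 ^ n), K, lam * Real.log 2, a * Real.log 2, hK, by positivity,
    by gcongr, fun n => hP _ Nat.one_le_two_pow, fun n => ?_, fun m n hmn x => ?_⟩
  · ext1 x
    exact coc_comm hAP Nat.one_le_two_pow (Nat.pow_le_pow_right two_pos n.le_succ) x
  · have := hb (2 ^ m) (2 ^ n) Nat.one_le_two_pow (Nat.pow_le_pow_right two_pos hmn) x
    simpa only [coc_dyadic, two_pow_div_two_pow_rpow, neg_mul] using this

theorem StrongExpDichotomyWRT.of_dyadic {A : ℕ → (E ≃L[ℝ] E)} {N : ℕ → E → ℝ}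
    (hN : ∀ n : ℕ, 1 ≤ n → ∀ x, 0 ≤ N n x) {K a : ℝ} (hK : 0 < K) (ha : 0 < a)
    (hbg : ∀ m n : ℕ, 1 ≤ n → n ≤ m → ∀ x : E,
      N m (coc A m n x) ≤ K * ((m : ℝ) / n) ^ a * N n x ∧
      N n (coc A n m x) ≤ K * ((m : ℝ) / n) ^ a * N m x)
    (h : StrongExpDichotomyWRT (fun n : ℕ => coc A (2 ^ (n + 1)) (2 ^ n))
      (fun n : ℕ => N (2 ^ n))) :
    StrongPolyDichotomyWRT A N := by
  obtain ⟨P', L, lam, _, hL, hlam, -, hP, hBP, hb⟩ := h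
  have hlog : 0 < Real.log 2 := Real.log_pos one_lt_two
  let P : ℕ → (E →L[ℝ] E) := fun n =>
    (coc A n 1 : E →L[ℝ] E).comp ((P' 0).comp (coc A 1 n : E →L[ℝ] E))
  have hPdef : ∀ n x, P n x = coc A n 1 (P' 0 (coc A 1 n x)) := fun _ _ => rfl
  have hcomm : ∀ m n x, coc A m n (P n x) = P m (coc A m n x) := by
    intro m n x
    simp [hPdef]
  have hPdyad : ∀ k x, P (2 ^ k) x = P' k x := by
    intro k x
    have := coc_comm (s := 0) (fun n _ => hBP n) le_rfl (Nat.zero_le k) (coc A 1 (2 ^ k) x)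
    simpa [coc_dyadic, hPdef] using this
  -- Transfer to the nearest lower power of two costs a bounded factor.
  have hup : ∀ n, 1 ≤ n → ∀ x, N n (coc A n (2 ^ Nat.log 2 n) x) ≤
      K * 2 ^ a * N (2 ^ Nat.log 2 n) x := fun n hn x =>
    ((hbg n _ Nat.one_le_two_pow (Nat.pow_log_le_self 2 (by omega)) x).1).trans
      (mul_le_mul_of_nonneg_right
        (mul_le_mul_of_nonneg_left (div_two_pow_log_rpow_le ha.le) hK.le)
        (hN _ Nat.one_le_two_pow x))
  have hdown : ∀ n, 1 ≤ n → ∀ x, N (2 ^ Nat.log 2 n) (coc A (2 ^ Nat.log 2 n) n x) ≤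
      K * 2 ^ a * N n x := fun n hn x =>
    ((hbg n _ Nat.one_le_two_pow (Nat.pow_log_le_self 2 (by omega)) x).2).trans
      (mul_le_mul_of_nonneg_right
        (mul_le_mul_of_nonneg_left (div_two_pow_log_rpow_le ha.le) hK.le) (hN n hn x))
  have hchain : ∀ {u v w z r D : ℝ}, 0 ≤ D → u ≤ K * 2 ^ a * v →
      v ≤ L * D * w → w ≤ K * 2 ^ a * z → 0 ≤ z → D ≤ Real.exp lam * r →
      u ≤ (K * 2 ^ a) ^ 2 * L * Real.exp lam * r * z := by
    intro u v w z r D hD huv hvw hwz hz hDr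
    calc u ≤ K * 2 ^ a * (L * D * (K * 2 ^ a * z)) :=
          huv.trans (by gcongr; exact hvw.trans (by gcongr))
      _ ≤ K * 2 ^ a * (L * (Real.exp lam * r) * (K * 2 ^ a * z)) := by gcongr
      _ = _ := by ring
  refine ⟨K + (K * 2 ^ a) ^ 2 * L * Real.exp lam, lam / Real.log 2, max a (lam / Real.log 2),
    by positivity, by positivity, le_max_right _ _, P, fun n _ => ?_, fun n _ => ?_,
    fun m n hn hmn x => ?_⟩
  · ext1 x
    have := DFunLike.congr_fun (hP 0) (coc A 1 n x)
    simp only [ContinuousLinearMap.comp_apply] at this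
    simp [hPdef, this]
  · ext1 x
    simpa [coc_succ] using hcomm (n + 1) n x
  have hm : 1 ≤ m := hn.trans hmn
  have hlm : Nat.log 2 n ≤ Nat.log 2 m := Nat.log_mono_right hmn
  have hexp := exp_neg_log_sub_log_le hn hm hlam.le
  have hn' : (0 : ℝ) < n := by exact_mod_cast hn
  have hone : 1 ≤ (m : ℝ) / n := by
    rw [one_le_div hn']
    exact_mod_cast hmn
  have hgrowth : K * ((m : ℝ) / n) ^ a ≤
      (K + (K * 2 ^ a) ^ 2 * L * Real.exp lam) * ((m : ℝ) / n) ^ max a (lam / Real.log 2) := by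
    gcongr
    · exact le_add_of_nonneg_right (by positivity)
    · exact le_max_left _ _
  have hdecay : (K * 2 ^ a) ^ 2 * L * Real.exp lam * ((m : ℝ) / n) ^ (-(lam / Real.log 2)) ≤
      (K + (K * 2 ^ a) ^ 2 * L * Real.exp lam) * ((m : ℝ) / n) ^ (-(lam / Real.log 2)) := by
    gcongr
    exact le_add_of_nonneg_left hK.le
  refine ⟨?_, ?_, ?_, ?_⟩
  · have h1 := hup m hm (coc A (2 ^ Nat.log 2 m) n (P n x))
    have h2 := (hb _ _ hlm (coc A (2 ^ Nat.log 2 n) n x)).1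
    rw [coc_dyadic, ← hPdyad, ← hcomm, coc_coc] at h2
    rw [coc_coc] at h1
    exact (hchain (Real.exp_nonneg _) h1 h2 (hdown n hn x) (hN n hn x) hexp).trans
      (mul_le_mul_of_nonneg_right hdecay (hN n hn x))
  · have h1 := hup n hn (coc A (2 ^ Nat.log 2 n) m (x - P m x))
    have h2 := (hb _ _ hlm (coc A (2 ^ Nat.log 2 m) m x)).2.1
    rw [coc_dyadic, ← hPdyad, ← hcomm, ← map_sub, coc_coc] at h2
    rw [coc_coc] at h1
    exact (hchain (Real.exp_nonneg _) h1 h2 (hdown m hm x) (hN m hm x) hexp).trans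
      (mul_le_mul_of_nonneg_right hdecay (hN m hm x))
  · exact ((hbg m n hn hmn x).1).trans (mul_le_mul_of_nonneg_right hgrowth (hN n hn x))
  · exact ((hbg m n hn hmn x).2).trans (mul_le_mul_of_nonneg_right hgrowth (hN m hm x))

/-- Proposition: polynomial dichotomy for `(A_n)` is equivalent to
exponential dichotomy for the dyadic reparametrization `B_n = 𝒜(2^{n+1}, 2^n)`. -/
theorem strongPolyDichotomyWRT_iff_strongExpDichotomyWRT_dyadic {d : ℕ}
    (A : ℕ → (EuclideanSpace ℝ (Fin d) ≃L[ℝ] EuclideanSpace ℝ (Fin d)))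
    (N : ℕ → EuclideanSpace ℝ (Fin d) → ℝ)
    (hN : ∀ n : ℕ, 1 ≤ n → IsNormOn (N n))
    (K a : ℝ) (hK : 0 < K) (ha : 0 < a)
    (hbg : ∀ m n : ℕ, 1 ≤ n → n ≤ m → ∀ x : EuclideanSpace ℝ (Fin d),
      N m (coc A m n x) ≤ K * ((m : ℝ) / n) ^ a * N n x ∧
      N n (coc A n m x) ≤ K * ((m : ℝ) / n) ^ a * N m x) :
    StrongPolyDichotomyWRT A N ↔
      StrongExpDichotomyWRT (fun n : ℕ => coc A (2 ^ (n + 1)) (2 ^ n))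
        (fun n : ℕ => N (2 ^ n)) := by
  exact ⟨StrongPolyDichotomyWRT.dyadic,
    StrongExpDichotomyWRT.of_dyadic (fun n hn => (hN n hn).1) hK ha hbg⟩

end NonautLin
end
end
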